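/- Let A be a real symmetric n×n matrix (n ≥ 1) with k_A = |ev_M(A)\{−2}| ≥ 1, and arrange the members of ev_M(A) ∪ {−2} in ascending order as α₁ < α₂ < … < α_{k_A+1}. Then for each 1 ≤ i ≤ k_A the open interval (−α_{i+1}−2, −α_i−2) contains exactly one zero of ω_A, and these k_A distinct real zeroes exhaust all zeroes of ω_A on its domain. -/

import Mathlib

open scoped BigOperators
open Filter Topology
open scoped Classical

namespace QECPaper

/-- The cone (join) `K₁ + H` over a graph `H`: vertex `none` is the apex. -/
def cone {V₂ : Type*} (H : SimpleGraph V₂) : SimpleGraph (Option V₂) where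
  Adj x y := (∃ a b, x = some a ∧ y = some b ∧ H.Adj a b) ∨
    (x = none ∧ y ≠ none) ∨ (x ≠ none ∧ y = none)
  symm := by
    constructor
    rintro x y (⟨a, b, rfl, rfl, h⟩ | ⟨rfl, hy⟩ | ⟨hx, rfl⟩)
    · exact Or.inl ⟨b, a, rfl, rfl, h.symm⟩
    · exact Or.inr (Or.inr ⟨hy, rfl⟩)
    · exact Or.inr (Or.inl ⟨rfl, hx⟩)
  loopless := by
    constructor
    rintro x (⟨a, b, rfl, hb, h⟩ | ⟨rfl, hy⟩ | ⟨hx, rfl⟩)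
    · exact H.loopless.irrefl a (by cases hb; exact h)
    · exact hy rfl
    · exact hx rfl

/-- The corona `G ⊙ H` of two graphs, realized on `V₁ × ({o} ∪ V₂)`
with `o = none`. -/
def corona {V₁ V₂ : Type*} (G : SimpleGraph V₁) (H : SimpleGraph V₂) :
    SimpleGraph (V₁ × Option V₂) where
  Adj p q := (p.1 = q.1 ∧ (cone H).Adj p.2 q.2) ∨
    (G.Adj p.1 q.1 ∧ p.2 = none ∧ q.2 = none)
  symm := by
    constructor
    rintro ⟨i, x⟩ ⟨j, y⟩ (⟨h1, h2⟩ | ⟨h1, h2, h3⟩)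
    · exact Or.inl ⟨h1.symm, (cone H).adj_symm h2⟩
    · exact Or.inr ⟨h1.symm, h3, h2⟩
  loopless := by
    constructor
    rintro ⟨i, x⟩ (⟨h1, h2⟩ | ⟨h1, h2, h3⟩)
    · exact (cone H).loopless.irrefl x h2
    · exact G.loopless.irrefl i h1

/-- The quadratic embedding constant of a (connected) graph on a finite vertex set. -/
noncomputable def QEC {V : Type*} [Fintype V] (G : SimpleGraph V) : ℝ :=
  sSup {r : ℝ | ∃ f : V → ℝ, (∑ x, f x ^ 2) = 1 ∧ (∑ x, f x) = 0 ∧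
    r = ∑ x, ∑ y, f x * (G.dist x y : ℝ) * f y}

/-- The set `λ(S)` of `λ` appearing in a solution of the basic equations. -/
def lambdaS {V : Type*} [Fintype V] (G : SimpleGraph V) : Set ℝ :=
  {lam : ℝ | ∃ (f : V → ℝ) (μ : ℝ),
    (∀ x, (∑ y, (G.dist x y : ℝ) * f y) - lam * f x = μ / 2) ∧
    (∑ x, f x) = 0 ∧ (∑ x, f x ^ 2) = 1}

/-- The distance matrix of a graph, with real entries. -/
noncomputable def distMatrix {V : Type*} (G : SimpleGraph V) : Matrix V V ℝ :=
  Matrix.of fun x y => (G.dist x y : ℝ)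

section MatrixFunctions

variable {ι : Type*} [Fintype ι] [DecidableEq ι]

/-- The eigenspace `ker (A - α)` inside `EuclideanSpace ℝ ι`. -/
noncomputable def eigSpace (A : Matrix ι ι ℝ) (α : ℝ) :
    Submodule ℝ (EuclideanSpace ℝ ι) :=
  LinearMap.ker (Matrix.toEuclideanLin A - α • LinearMap.id)

/-- The all-ones vector of `EuclideanSpace ℝ ι`. -/
noncomputable def onesE (ι : Type*) [Fintype ι] : EuclideanSpace ℝ ι :=
  (WithLp.equiv 2 (ι → ℝ)).symm (fun _ => 1)

/-- `‖E_α 𝟏‖²`, where `E_α` is the orthogonal projection of `EuclideanSpace ℝ ι`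
onto the eigenspace `ker (A - α)`. -/
noncomputable def projNormSq (A : Matrix ι ι ℝ) (α : ℝ) : ℝ :=
  ‖(Submodule.orthogonalProjectionOnto (eigSpace A α) (onesE ι) : EuclideanSpace ℝ ι)‖ ^ 2

/-- The set of (real) eigenvalues of a matrix. -/
def evSet (A : Matrix ι ι ℝ) : Set ℝ :=
  {α : ℝ | ∃ v : ι → ℝ, v ≠ 0 ∧ A.mulVec v = α • v}

/-- The set of main eigenvalues: those `α` with `E_α 𝟏 ≠ 0`. -/
def mainEv (A : Matrix ι ι ℝ) : Set ℝ := {α : ℝ | projNormSq A α ≠ 0}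

/-- `k_A = |ev_M(A) \ {-2}|`. -/
noncomputable def kA (A : Matrix ι ι ℝ) : ℕ := (mainEv A \ {(-2 : ℝ)}).ncard

/-- The ω-function associated with the symmetric matrix `A`. -/
noncomputable def omegaFun (A : Matrix ι ι ℝ) (lam : ℝ) : ℝ :=
  1 + projNormSq A (-2) +
    ∑ᶠ α ∈ mainEv A \ {(-2 : ℝ)}, lam / (α + 2 + lam) * projNormSq A α

/-- The (maximal) domain of the ω-function: the complement of its poles. -/
def omegaDomain (A : Matrix ι ι ℝ) : Set ℝ :=
  {lam : ℝ | ∀ α ∈ mainEv A \ {(-2 : ℝ)}, lam ≠ -α - 2}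

/-- The set of zeroes of the ω-function (on its domain). -/
def omegaZeros (A : Matrix ι ι ℝ) : Set ℝ :=
  {lam : ℝ | lam ∈ omegaDomain A ∧ omegaFun A lam = 0}

/-- `λ*`, the largest zero of the ω-function. -/
noncomputable def lamStar (A : Matrix ι ι ℝ) : ℝ := sSup (omegaZeros A)

/-- The ψ-function associated with `A`: `ψ_A(λ) = λ/ω_A(λ)` extended
analytically across the poles of `ω_A` by the value `0`. -/
noncomputable def psiFun (A : Matrix ι ι ℝ) (lam : ℝ) : ℝ :=
  if -lam - 2 ∈ mainEv A \ {(-2 : ℝ)} then 0 else lam / omegaFun A lam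

/-- The inverse of the rightmost branch `ψ_{A*} = ψ_A ↾ (λ*, +∞)`:
`ψ_{A*}⁻¹(y)` is the unique `λ > λ*` with `ψ_A(λ) = y`. -/
noncomputable def psiStarInv (A : Matrix ι ι ℝ) (y : ℝ) : ℝ :=
  sSup {lam : ℝ | lamStar A < lam ∧ psiFun A lam = y}

end MatrixFunctions


/-- Each summand of a Stieltjes sum is strictly decreasing away from its pole. -/
theorem div_add_lt_div_add {d b x y : ℝ} (hd : 0 < d) (hxy : x < y)
    (hb : 0 < b + x ∨ b + y < 0) : d / (b + y) < d / (b + x) := by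
  rcases hb with hb | hb
  · exact div_lt_div_of_pos_left hd hb (by linarith)
  · have h : d / -(b + x) < d / -(b + y) :=
      div_lt_div_of_pos_left hd (by linarith) (by linarith)
    rw [div_neg, div_neg] at h
    linarith

section StieltjesSum

variable {k : ℕ} {b d : Fin (k + 1) → ℝ}

/-- Between two consecutive poles, every `b j + x` keeps its sign. -/
theorem pos_or_neg_of_mem_Ioo (hb : StrictMono b) (i : Fin k) {x y : ℝ}
    (hx : -b i.succ < x) (hy : y < -b i.castSucc) (j : Fin (k + 1)) :
    0 < b j + x ∨ b j + y < 0 := by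
  rcases le_or_gt j i.castSucc with h | h
  · right
    have := hb.monotone h
    linarith
  · left
    have := hb.monotone (Fin.castSucc_lt_iff_succ_le.mp h)
    linarith

/-- A positive Stieltjes sum has a zero between any two consecutive poles. -/
theorem exists_stieltjes_zero (hb : StrictMono b) (hd : ∀ j, 0 < d j) (i : Fin k) :
    ∃ x ∈ Set.Ioo (-b i.succ) (-b i.castSucc), ∑ j, d j / (b j + x) = 0 := by
  have hlt : b i.castSucc < b i.succ := hb i.castSucc_lt_succ
  have hne : i.succ ≠ i.castSucc := i.castSucc_lt_succ.ne'
  set s : Finset (Fin (k + 1)) := (Finset.univ.erase i.castSucc).erase i.succ with hs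
  -- The sum with the two adjacent denominators cleared.
  set P : ℝ → ℝ := fun x => d i.castSucc * (b i.succ + x) + d i.succ * (b i.castSucc + x) +
    (b i.succ + x) * (b i.castSucc + x) * ∑ j ∈ s, d j / (b j + x) with hP
  have hcont : ContinuousOn P (Set.Icc (-b i.succ) (-b i.castSucc)) := by
    refine ContinuousOn.add (by fun_prop) (ContinuousOn.mul (by fun_prop) ?_)
    refine continuousOn_finsetSum _ fun j hj => ?_
    refine ContinuousOn.div (by fun_prop) (by fun_prop) fun x hx => ?_
    simp only [hs, Finset.mem_erase, Finset.mem_univ, and_true] at hj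
    rcases lt_or_gt_of_ne hj.2 with h | h
    · have := hb h
      linarith [hx.2]
    · have := hb (lt_of_le_of_ne (Fin.castSucc_lt_iff_succ_le.mp h) hj.1.symm)
      linarith [hx.1]
  have hleft : P (-b i.succ) < 0 := by
    have := mul_pos (hd i.succ) (sub_pos.mpr hlt)
    simp only [hP]
    ring_nf at this ⊢
    linarith
  have hright : 0 < P (-b i.castSucc) := by
    have := mul_pos (hd i.castSucc) (sub_pos.mpr hlt)
    simp only [hP]
    ring_nf at this ⊢
    linarith
  obtain ⟨x, hx, hPx⟩ := intermediate_value_Ioo (by linarith) hcont ⟨hleft, hright⟩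
  refine ⟨x, hx, ?_⟩
  have h₁ : b i.succ + x ≠ 0 := by linarith [hx.1]
  have h₂ : b i.castSucc + x ≠ 0 := by linarith [hx.2]
  rw [← Finset.add_sum_erase _ _ (Finset.mem_univ i.castSucc),
    ← Finset.add_sum_erase _ _ (Finset.mem_erase.mpr ⟨hne, Finset.mem_univ i.succ⟩)]
  simp only [hP] at hPx
  field_simp
  linear_combination hPx

/-- A positive Stieltjes sum has at most one zero between two consecutive poles. -/
theorem stieltjes_zero_unique (hb : StrictMono b) (hd : ∀ j, 0 < d j) (i : Fin k) {x y : ℝ}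
    (hx : x ∈ Set.Ioo (-b i.succ) (-b i.castSucc)) (hy : y ∈ Set.Ioo (-b i.succ) (-b i.castSucc))
    (hx₀ : ∑ j, d j / (b j + x) = 0) (hy₀ : ∑ j, d j / (b j + y) = 0) : x = y := by
  have decreasing : ∀ {u v : ℝ}, -b i.succ < u → v < -b i.castSucc → u < v →
      ∑ j, d j / (b j + v) < ∑ j, d j / (b j + u) := fun hu hv huv =>
    Finset.sum_lt_sum_of_nonempty Finset.univ_nonempty fun j _ =>
      div_add_lt_div_add (hd j) huv (pos_or_neg_of_mem_Ioo hb i hu hv j)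
  rcases lt_trichotomy x y with h | h | h
  · exact absurd (decreasing hx.1 hy.2 h) (by rw [hx₀, hy₀]; exact lt_irrefl _)
  · exact h
  · exact absurd (decreasing hy.1 hx.2 h) (by rw [hx₀, hy₀]; exact lt_irrefl _)

/-- Every zero of a positive Stieltjes sum lies between two consecutive poles. -/
theorem exists_mem_Ioo_of_stieltjes_zero (hb : StrictMono b) (hd : ∀ j, 0 < d j) {x : ℝ}
    (hx : ∀ j, b j + x ≠ 0) (hx₀ : ∑ j, d j / (b j + x) = 0) :
    ∃ i : Fin k, x ∈ Set.Ioo (-b i.succ) (-b i.castSucc) := by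
  by_contra! hno
  rcases lt_or_gt_of_ne (hx 0) with h₀ | h₀
  · have hneg : ∀ j, b j + x < 0 := fun j => by
      induction j using Fin.induction with
      | zero => exact h₀
      | succ i ih =>
        refine lt_of_le_of_ne (not_lt.mp fun h => hno i ⟨?_, ?_⟩) (hx _) <;> linarith
    exact (Finset.sum_neg (fun j _ => div_neg_of_pos_of_neg (hd j) (hneg j))
      Finset.univ_nonempty).ne hx₀
  · have hpos : ∀ j, 0 < b j + x := fun j => by
      have := hb.monotone (Fin.zero_le j)
      linarith
    exact (Finset.sum_pos (fun j _ => div_pos (hd j) (hpos j)) Finset.univ_nonempty).ne' hx₀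

end StieltjesSum

section OmegaWeights

variable {ι : Type*} [Fintype ι] [DecidableEq ι]

/-- The residues of `ω_A(λ) / λ`: at `λ = -a - 2` the residue is `omegaWeight A a`. -/
noncomputable def omegaWeight (A : Matrix ι ι ℝ) (a : ℝ) : ℝ :=
  if a = -2 then 1 + projNormSq A (-2) else projNormSq A a

theorem projNormSq_nonneg (A : Matrix ι ι ℝ) (a : ℝ) : 0 ≤ projNormSq A a := sq_nonneg _

theorem omegaWeight_pos {A : Matrix ι ι ℝ} {a : ℝ} (ha : a ∈ mainEv A ∪ {(-2 : ℝ)}) :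
    0 < omegaWeight A a := by
  unfold omegaWeight
  split_ifs with h
  · linarith [projNormSq_nonneg A (-2)]
  · exact lt_of_le_of_ne (projNormSq_nonneg A a) (Ne.symm (ha.resolve_right h))

theorem omegaFun_zero (A : Matrix ι ι ℝ) : omegaFun A 0 = 1 + projNormSq A (-2) := by
  simp [omegaFun]

/-- Partial fraction expansion of `ω_A(λ) / λ`. -/
theorem omegaFun_eq_mul_sum {κ : Type*} [Fintype κ] (A : Matrix ι ι ℝ) {α : κ → ℝ}
    (hα : Function.Injective α) (hrange : Set.range α = mainEv A ∪ {(-2 : ℝ)})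
    {x : ℝ} (hx : x ≠ 0) :
    omegaFun A x = x * ∑ j, omegaWeight A (α j) / (α j + 2 + x) := by
  have hset : mainEv A \ {(-2 : ℝ)} = ((Finset.univ.image α).erase (-2) : Finset ℝ) := by
    rw [Finset.coe_erase, Finset.coe_image, Finset.coe_univ, Set.image_univ, hrange,
      Set.union_sdiff_right]
  have hmem : (-2 : ℝ) ∈ Finset.univ.image α := by
    rw [← Finset.mem_coe, Finset.coe_image, Finset.coe_univ, Set.image_univ, hrange]
    exact Or.inr rfl
  have himage : ∑ j, omegaWeight A (α j) / (α j + 2 + x) =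
      ∑ a ∈ Finset.univ.image α, omegaWeight A a / (a + 2 + x) :=
    (Finset.sum_image (f := fun a => omegaWeight A a / (a + 2 + x)) hα.injOn).symm
  rw [omegaFun, hset, finsum_mem_coe_finset, himage, ← Finset.add_sum_erase _ _ hmem, mul_add,
    Finset.mul_sum]
  congr 1
  · rw [omegaWeight, if_pos rfl, neg_add_cancel, zero_add, mul_div_cancel₀ _ hx]
  · refine Finset.sum_congr rfl fun a ha => ?_
    rw [omegaWeight, if_neg (Finset.mem_erase.mp ha).1]
    ring

theorem mem_omegaZeros_iff {κ : Type*} [Fintype κ] (A : Matrix ι ι ℝ) {α : κ → ℝ}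
    (hα : Function.Injective α) (hrange : Set.range α = mainEv A ∪ {(-2 : ℝ)}) {x : ℝ} :
    x ∈ omegaZeros A ↔
      (∀ j, α j + 2 + x ≠ 0) ∧ ∑ j, omegaWeight A (α j) / (α j + 2 + x) = 0 := by
  constructor
  · rintro ⟨hdom, hzero⟩
    have hx : x ≠ 0 := by
      rintro rfl
      rw [omegaFun_zero] at hzero
      linarith [projNormSq_nonneg A (-2)]
    refine ⟨fun j hj => ?_, ?_⟩
    · by_cases h : α j = -2
      · exact hx (by linarith)
      · have hmem : α j ∈ mainEv A ∪ {(-2 : ℝ)} := hrange ▸ Set.mem_range_self j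
        exact hdom _ ⟨hmem.resolve_right h, h⟩ (by linarith)
    · rw [omegaFun_eq_mul_sum A hα hrange hx] at hzero
      exact (mul_eq_zero.mp hzero).resolve_left hx
  · rintro ⟨hne, hzero⟩
    have hx : x ≠ 0 := by
      obtain ⟨j, hj⟩ : (-2 : ℝ) ∈ Set.range α := hrange ▸ Or.inr rfl
      simpa [hj] using hne j
    refine ⟨fun a ha hxa => ?_, ?_⟩
    · obtain ⟨j, hj⟩ : a ∈ Set.range α := hrange ▸ Or.inl ha.1
      exact hne j (by linarith)
    · rw [omegaFun_eq_mul_sum A hα hrange hx, hzero, mul_zero]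

end OmegaWeights

/-- Location of the zeroes of the ω-function. -/
theorem omegaFun_zeroes {n : ℕ} (hn : 1 ≤ n)
    (A : Matrix (Fin n) (Fin n) ℝ) (hA : A.IsSymm)
    (k : ℕ) (hkk : kA A = k) (hk : 1 ≤ k)
    (α : Fin (k + 1) → ℝ) (hmono : StrictMono α)
    (hrange : Set.range α = mainEv A ∪ {(-2 : ℝ)}) :
    (∀ i : Fin k, ∃! lam : ℝ,
        lam ∈ Set.Ioo (-(α i.succ) - 2) (-(α i.castSucc) - 2) ∧ lam ∈ omegaZeros A) ∧
    omegaZeros A ⊆ ⋃ i : Fin k, Set.Ioo (-(α i.succ) - 2) (-(α i.castSucc) - 2) := by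
  have hb : StrictMono fun j => α j + 2 := fun _ _ h => add_lt_add_left (hmono h) 2
  have hd : ∀ j, 0 < omegaWeight A (α j) := fun j =>
    omegaWeight_pos (hrange ▸ Set.mem_range_self j)
  simp only [mem_omegaZeros_iff A hmono.injective hrange, ← neg_add']
  refine ⟨fun i => ?_, fun x hx => ?_⟩
  · obtain ⟨x, hx, hx₀⟩ := exists_stieltjes_zero hb hd i
    refine ⟨x, ⟨hx, fun j => ?_, hx₀⟩, fun y hy => ?_⟩
    · exact (pos_or_neg_of_mem_Ioo hb i hx.1 hx.2 j).elim ne_of_gt ne_of_lt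
    · exact stieltjes_zero_unique hb hd i hy.1 hx hy.2.2 hx₀
  · obtain ⟨hne, hzero⟩ := (mem_omegaZeros_iff A hmono.injective hrange).mp hx
    exact Set.mem_iUnion.mpr (exists_mem_Ioo_of_stieltjes_zero hb hd hne hzero)

end QECPaper
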